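/- Let g : ℕ → ℤ be a normalized arithmetic function (g(1) = 1), let A_n^g(x) := n! · P_n^g(x) ∈ ℤ[x], and let p be a prime. Then for all ℓ ≥ 0 and all 0 ≤ r < p, the reductions modulo p satisfy A_{ℓp+r}^g(x) ≡ A_r^g(x) · (A_p^g(x))^ℓ in 𝔽_p[x]. -/

import Mathlib

open Polynomial

/-- The polynomials `P_n^g ∈ ℚ[X]` defined by `P_0^g = 1` and
`P_n^g = (x/n) ∑_{k=1}^n g(k) P_{n-k}^g` for `n ≥ 1`. -/
noncomputable def darcais (g : ℕ → ℤ) : ℕ → ℚ[X]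
  | 0 => 1
  | n + 1 =>
      C (((n : ℚ) + 1)⁻¹) * X *
        ∑ k ∈ Finset.range (n + 1), C ((g (k + 1) : ℚ)) * darcais g (n - k)
  decreasing_by exact Nat.sub_lt_succ n k

/-- `A_n^g := n! ⬝ P_n^g`. -/
noncomputable def darcaisA (g : ℕ → ℤ) (n : ℕ) : ℚ[X] :=
  (n.factorial : ℚ[X]) * darcais g n

/-- Sum-of-divisors function `σ` as a `ℤ`-valued arithmetic function. -/
def sigma' (n : ℕ) : ℤ := ∑ d ∈ n.divisors, (d : ℤ)

/-- The integral form of the polynomials `A_n^g`, defined by `A_0^g = 1` and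
`A_{n+1}^g = x ∑_{k=0}^n n(n-1)⋯(n-k+1) g(k+1) A_{n-k}^g`. -/
noncomputable def darcaisInt (g : ℕ → ℤ) : ℕ → ℤ[X]
  | 0 => 1
  | n + 1 =>
      X * ∑ k ∈ Finset.range (n + 1),
        C ((n.descFactorial k : ℤ) * g (k + 1)) * darcaisInt g (n - k)
  decreasing_by exact Nat.sub_lt_succ n k

theorem map_darcaisInt (g : ℕ → ℤ) (n : ℕ) :
    (darcaisInt g n).map (Int.castRingHom ℚ) = darcaisA g n := by
  induction n using Nat.strong_induction_on with
  | _ n ih =>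
    cases n with
    | zero => simp [darcaisInt, darcaisA, darcais]
    | succ n =>
      have hfac : ((n + 1).factorial : ℚ[X]) * C (((n : ℚ) + 1)⁻¹) = (n.factorial : ℚ[X]) := by
        rw [← C_eq_natCast, ← C_eq_natCast, ← C_mul, Nat.factorial_succ]
        congr 1
        push_cast
        field_simp
      rw [darcaisInt, darcaisA, darcais, ← mul_assoc, ← mul_assoc, hfac, Polynomial.map_mul, map_X,
        mul_comm (n.factorial : ℚ[X]) X, mul_assoc, Polynomial.map_sum,
        Finset.mul_sum _ _ (n.factorial : ℚ[X])]
      refine congrArg (X * ·) (Finset.sum_congr rfl fun k hk => ?_)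
      have hkn : k ≤ n := Nat.lt_succ_iff.mp (Finset.mem_range.mp hk)
      rw [Polynomial.map_mul, ih (n - k) (Nat.sub_lt_succ n k), darcaisA,
        ← Nat.factorial_mul_descFactorial hkn]
      simp
      ring

theorem map_eq_map_darcaisInt {g : ℕ → ℤ} {n : ℕ} {B : ℤ[X]} {R : Type*} [Ring R]
    (hB : B.map (Int.castRingHom ℚ) = darcaisA g n) :
    B.map (Int.castRingHom R) = (darcaisInt g n).map (Int.castRingHom R) := by
  rw [map_injective _ Int.cast_injective (hB.trans (map_darcaisInt g n).symm)]

theorem Nat.cast_add_descFactorial_of_cast_eq_zero {R : Type*} [Ring R] {m : ℕ}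
    (hm : (m : R) = 0) (n k : ℕ) :
    ((m + n).descFactorial k : R) = (n.descFactorial k : R) := by
  rw [← descPochhammer_eval_eq_descFactorial, ← descPochhammer_eval_eq_descFactorial,
    Nat.cast_add, hm, zero_add]

theorem map_darcaisInt_add {R : Type*} [CommRing R] (g : ℕ → ℤ) {m : ℕ} (hm : (m : R) = 0)
    (n : ℕ) :
    (darcaisInt g (m + n)).map (Int.castRingHom R) =
      (darcaisInt g n).map (Int.castRingHom R) * (darcaisInt g m).map (Int.castRingHom R) := by
  induction n using Nat.strong_induction_on with
  | _ n ih =>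
    cases n with
    | zero => simp [darcaisInt]
    | succ n =>
      have hmX : (m : R[X]) = 0 := by rw [← C_eq_natCast, hm, C_0]
      rw [← add_assoc, darcaisInt, darcaisInt]
      simp only [Polynomial.map_mul, map_X, Polynomial.map_sum, map_C, map_mul, map_natCast,
        Polynomial.map_natCast, Nat.cast_add_descFactorial_of_cast_eq_zero hmX, mul_assoc, Finset.sum_mul]
      refine congrArg (X * ·) (Finset.sum_subset_zero_on_sdiff
        (Finset.range_mono (by omega : n + 1 ≤ m + n + 1)) ?_ ?_).symm
      · intro k hk
        have hk' : n < k := by simp at hk; omega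
        simp [Nat.descFactorial_of_lt hk']
      · intro k hk
        have hkn : k ≤ n := Nat.lt_succ_iff.mp (Finset.mem_range.mp hk)
        rw [Nat.add_sub_assoc hkn, ih (n - k) (Nat.sub_lt_succ n k)]

theorem map_darcaisInt_mul {R : Type*} [CommRing R] (g : ℕ → ℤ) {m : ℕ} (hm : (m : R) = 0)
    (l : ℕ) :
    (darcaisInt g (l * m)).map (Int.castRingHom R) =
      (darcaisInt g m).map (Int.castRingHom R) ^ l := by
  induction l with
  | zero => simp [darcaisInt]
  | succ l ih =>
    rw [Nat.succ_mul, map_darcaisInt_add g (by simp [hm]), ih, pow_succ']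

/-- Lemma 6, first part: if `g(1) = 1` and `p` is prime, then for `ℓ ≥ 0` and
`0 ≤ r < p` the reductions mod `p` satisfy
`A_{ℓp+r}^g ≡ A_r^g ⬝ (A_p^g)^ℓ` in `𝔽_p[x]`.  (The reductions are formalized by
quantifying over the integer polynomials lifting the `A`'s.) -/
theorem darcaisA_reduction_mod_p (g : ℕ → ℤ) (hg1 : g 1 = 1)
    (p : ℕ) (hp : p.Prime) (ℓ r : ℕ) (hr : r < p)
    (B Br Bp : ℤ[X])
    (hB : B.map (Int.castRingHom ℚ) = darcaisA g (ℓ * p + r))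
    (hBr : Br.map (Int.castRingHom ℚ) = darcaisA g r)
    (hBp : Bp.map (Int.castRingHom ℚ) = darcaisA g p) :
    B.map (Int.castRingHom (ZMod p)) =
      Br.map (Int.castRingHom (ZMod p)) * (Bp.map (Int.castRingHom (ZMod p))) ^ ℓ := by
  rw [map_eq_map_darcaisInt hB, map_eq_map_darcaisInt hBr, map_eq_map_darcaisInt hBp,
    map_darcaisInt_add g (by simp), map_darcaisInt_mul g (by simp)]
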